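/- Let N ≥ 2, 1 < p < N, p < q < ∞, p* := Np/(N−p), r > p*, and let a : ℤ^N → [0,∞) satisfy a(x) → +∞ as |x| → ∞. Then for each t > 0 there exist u : ℤ^N → ℝ and λ > 0 such that u(x) > 0 for all x, Σ_{x∈ℤ^N} |u(x)|^r = rt, ρ(∇u) < ∞, I(u) = S_t, and L u(x₀) = λ u(x₀)^{r−1} for every x₀ ∈ ℤ^N. -/

import Mathlib

open Filter Topology
open scoped ENNReal Classical

noncomputable section

abbrev ZN (N : ℕ) := Fin N → ℤ

def adj {N : ℕ} (x y : ZN N) : Prop := (∑ i, (x i - y i).natAbs) = 1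

def eInt {N : ℕ} (g : ZN N → ZN N → ℝ) : ℝ≥0∞ :=
  (∑' e : ZN N × ZN N, if adj e.1 e.2 then ENNReal.ofReal (g e.1 e.2) else 0) / 2

def grad {N : ℕ} (u : ZN N → ℝ) (x y : ZN N) : ℝ := u y - u x

def energy {N : ℕ} (p q : ℝ) (a u : ZN N → ℝ) : ℝ≥0∞ :=
  eInt (fun x y => (1 / p) * |grad u x y| ^ p + (a x / q) * |grad u x y| ^ q)

def gradModular {N : ℕ} (p q : ℝ) (a u : ZN N → ℝ) : ℝ≥0∞ :=
  eInt (fun x y => |grad u x y| ^ p + a x * |grad u x y| ^ q)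

def vsum {N : ℕ} (r : ℝ) (u : ZN N → ℝ) : ℝ≥0∞ :=
  ∑' x : ZN N, ENNReal.ofReal (|u x| ^ r)

def Slevel {N : ℕ} (p q : ℝ) (a : ZN N → ℝ) (r t : ℝ) : ℝ≥0∞ :=
  sInf { c : ℝ≥0∞ | ∃ u : ZN N → ℝ, (Function.support u).Finite ∧
      vsum r u = ENNReal.ofReal (r * t) ∧ energy p q a u = c }

def Lop {N : ℕ} (p q : ℝ) (a u : ZN N → ℝ) (x₀ : ZN N) : ℝ :=
  -(∑' y : ZN N, if adj x₀ y then |u y - u x₀| ^ (p - 2) * (u y - u x₀) else 0)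
    - ∑' y : ZN N, if adj x₀ y then
        ((a x₀ + a y) / 2) * (|u y - u x₀| ^ (q - 2) * (u y - u x₀)) else 0

lemma pi_count_eq_count {ι : Type*} [Fintype ι] :
    MeasureTheory.Measure.pi (fun _ : ι => (MeasureTheory.Measure.count : MeasureTheory.Measure ℤ))
      = MeasureTheory.Measure.count := by
  refine MeasureTheory.Measure.ext_of_singleton fun x => ?_
  rw [MeasureTheory.Measure.pi_singleton]
  simp

/-- The grid-lines (Loomis-Whitney type) inequality on the lattice. -/
lemma tsum_prod_tsum_rpow_le {N : ℕ} (hN : 2 ≤ N) (f : ZN N → ℝ≥0∞) :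
    ∑' x : ZN N, ∏ i, (∑' j : ℤ, f (Function.update x i j)) ^ ((1 : ℝ) / ((N : ℝ) - 1))
      ≤ (∑' x, f x) ^ ((N : ℝ) / ((N : ℝ) - 1)) := by
  have hN' : (2 : ℝ) ≤ N := by exact_mod_cast hN
  have hc : Real.HolderConjugate (Fintype.card (Fin N) : ℝ) ((N : ℝ) / ((N : ℝ) - 1)) := by
    simp only [Fintype.card_fin]
    exact Real.HolderConjugate.conjExponent (by linarith)
  have := MeasureTheory.lintegral_prod_lintegral_pow_le
    (fun _ : Fin N => (MeasureTheory.Measure.count : MeasureTheory.Measure ℤ)) hc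
    (f := f) (measurable_of_countable f)
  rw [pi_count_eq_count] at this
  simpa [MeasureTheory.lintegral_count] using this

/-- A finitely supported function on `ℤ` is bounded by its total variation. -/
lemma ofReal_abs_le_tsum_abs_sub {f : ℤ → ℝ} (hf : (Function.support f).Finite) (m : ℤ) :
    ENNReal.ofReal |f m| ≤ ∑' j : ℤ, ENNReal.ofReal |f (j + 1) - f j| := by
  have hinj : Function.Injective (fun k : ℕ => m - (k : ℤ)) := fun a b h => by
    simpa using h
  obtain ⟨k, hk⟩ : ∃ k : ℕ, f (m - k) = 0 := by
    by_contra! h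
    exact Set.infinite_of_injective_forall_mem hinj (fun k => (h k : _ ∈ Function.support f)) hf
  have htel : f m = ∑ j ∈ Finset.range k, (f (m - k + j + 1) - f (m - k + j)) := by
    have := Finset.sum_range_sub (fun j : ℕ => f (m - k + j)) k
    simp only [Nat.cast_add, Nat.cast_one, Nat.cast_zero, add_zero, hk, sub_zero,
      sub_add_cancel, ← add_assoc] at this
    exact this.symm
  have hinj' : Function.Injective (fun j : ℕ => m - (k : ℤ) + j) := fun a b h => by
    simpa using h
  calc ENNReal.ofReal |f m|
      ≤ ENNReal.ofReal (∑ j ∈ Finset.range k, |f (m - k + j + 1) - f (m - k + j)|) := by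
        refine ENNReal.ofReal_le_ofReal ?_
        conv_lhs => rw [htel]
        exact Finset.abs_sum_le_sum_abs _ _
    _ = ∑ j ∈ Finset.range k, ENNReal.ofReal |f (m - k + j + 1) - f (m - k + j)| :=
        ENNReal.ofReal_sum_of_nonneg fun _ _ => abs_nonneg _
    _ ≤ ∑' j : ℕ, ENNReal.ofReal |f (m - k + j + 1) - f (m - k + j)| := ENNReal.sum_le_tsum _
    _ ≤ _ := ENNReal.tsum_comp_le_tsum_of_injective hinj'
        (fun j : ℤ => ENNReal.ofReal |f (j + 1) - f j|)

lemma update_add_one {N : ℕ} (x : ZN N) (i : Fin N) (j : ℤ) :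
    Function.update x i (j + 1) = Function.update x i j + Pi.single i 1 := by
  ext k
  by_cases h : k = i
  · subst h; simp
  · simp [h]

/-- The Gagliardo-Nirenberg inequality for the exponent `1` on the lattice. -/
lemma tsum_rpow_le_tsum_grad {N : ℕ} (hN : 2 ≤ N) {f : ZN N → ℝ}
    (hf : (Function.support f).Finite) :
    ∑' x, ENNReal.ofReal |f x| ^ ((N : ℝ) / ((N : ℝ) - 1)) ≤
      (∑ i, ∑' x, ENNReal.ofReal |f (x + Pi.single i 1) - f x|) ^ ((N : ℝ) / ((N : ℝ) - 1)) := by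
  have hN' : (2 : ℝ) ≤ N := by exact_mod_cast hN
  set G : ZN N → ℝ≥0∞ := fun x => ∑ i, ENNReal.ofReal |f (x + Pi.single i 1) - f x| with hG
  have hGs : ∑' x, G x = ∑ i, ∑' x, ENNReal.ofReal |f (x + Pi.single i 1) - f x| :=
    Summable.tsum_finsetSum fun _ _ => ENNReal.summable
  rw [← hGs]
  refine le_trans (ENNReal.tsum_le_tsum fun x => ?_) (tsum_prod_tsum_rpow_le hN G)
  have hx : ∀ i, ENNReal.ofReal |f x| ≤ ∑' j : ℤ, G (Function.update x i j) := by
    intro i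
    have hinj : Function.Injective (fun j : ℤ => Function.update x i j) :=
      Function.update_injective x i
    have := ofReal_abs_le_tsum_abs_sub (f := fun j => f (Function.update x i j))
      (hf.preimage hinj.injOn) (x i)
    simp only [Function.update_eq_self] at this
    refine this.trans (ENNReal.tsum_le_tsum fun j => ?_)
    rw [update_add_one]
    exact Finset.single_le_sum (f := fun i' => ENNReal.ofReal
      |f (Function.update x i j + Pi.single i' 1) - f (Function.update x i j)|)
      (fun _ _ => zero_le) (Finset.mem_univ i)
  calc ENNReal.ofReal |f x| ^ ((N : ℝ) / ((N : ℝ) - 1))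
      = ∏ i : Fin N, ENNReal.ofReal |f x| ^ ((1 : ℝ) / ((N : ℝ) - 1)) := by
        rw [Finset.prod_const, Finset.card_univ, Fintype.card_fin, ← ENNReal.rpow_natCast,
          ← ENNReal.rpow_mul]
        congr 1
        field_simp
    _ ≤ _ := Finset.prod_le_prod' fun i _ =>
        ENNReal.rpow_le_rpow (hx i) (div_nonneg zero_le_one (by linarith))

lemma abs_rpow_sub_rpow_le {b c g : ℝ} (hb : 0 ≤ b) (hc : 0 ≤ c) (hg : 1 < g) :
    |c ^ g - b ^ g| ≤ g * ((c ^ (g - 1) + b ^ (g - 1)) * |c - b|) := by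
  have key : ∀ b c : ℝ, 0 ≤ b → b ≤ c → c ^ g - b ^ g ≤ g * c ^ (g - 1) * (c - b) := by
    intro b c hb hbc
    rcases hbc.eq_or_lt with h | h
    · simp [h]
    obtain ⟨z, hz, hz'⟩ := exists_hasDerivAt_eq_slope (fun x : ℝ => x ^ g)
      (fun x => g * x ^ (g - 1)) h
      (continuous_id.rpow_const fun _ => Or.inr (by linarith)).continuousOn
      (fun x _ => Real.hasDerivAt_rpow_const (Or.inr hg.le))
    rw [eq_div_iff (by linarith)] at hz'
    rw [← hz']
    have : z ^ (g - 1) ≤ c ^ (g - 1) :=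
      Real.rpow_le_rpow (hb.trans hz.1.le) hz.2.le (by linarith)
    have h0 : 0 ≤ c - b := by linarith
    gcongr
  have h1 : 0 ≤ b ^ (g - 1) := Real.rpow_nonneg hb _
  have h2 : 0 ≤ c ^ (g - 1) := Real.rpow_nonneg hc _
  rcases le_total b c with h | h
  · rw [abs_of_nonneg (sub_nonneg.2 (Real.rpow_le_rpow hb h (by linarith))),
      abs_of_nonneg (sub_nonneg.2 h)]
    refine (key b c hb h).trans ?_
    have := mul_nonneg (by linarith : 0 ≤ g) (mul_nonneg h1 (sub_nonneg.2 h))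
    linarith
  · rw [abs_of_nonpos (sub_nonpos.2 (Real.rpow_le_rpow hc h (by linarith))),
      abs_of_nonpos (sub_nonpos.2 h)]
    have h3 := key c b hc h
    have := mul_nonneg (by linarith : 0 ≤ g) (mul_nonneg h2 (sub_nonneg.2 h))
    linarith

lemma ENNReal.tsum_mul_le_Lp_mul_Lq {α : Type*} [Countable α] {p q : ℝ}
    (hpq : p.HolderConjugate q) (f g : α → ℝ≥0∞) :
    ∑' x, f x * g x ≤ (∑' x, f x ^ p) ^ (1 / p) * (∑' x, g x ^ q) ^ (1 / q) := by
  let : MeasurableSpace α := ⊤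
  have := ENNReal.lintegral_mul_le_Lp_mul_Lq (MeasureTheory.Measure.count (α := α)) hpq
    (measurable_of_countable f).aemeasurable (measurable_of_countable g).aemeasurable
  simpa [MeasureTheory.lintegral_count] using this

lemma adj_add_single {N : ℕ} (x : ZN N) (i : Fin N) : adj x (x + Pi.single i 1) := by
  unfold adj
  rw [Finset.sum_eq_single i] <;> simp +contextual

/-- Sobolev inequality on the lattice. -/
lemma sobolev {N : ℕ} (hN : 2 ≤ N) {p : ℝ} (hp : 1 < p) (hpN : p < (N : ℝ)) :
    ∃ K : ℝ≥0∞, K ≠ ⊤ ∧ ∀ v : ZN N → ℝ, (∀ x, 0 ≤ v x) → (Function.support v).Finite →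
      ∑' x, ENNReal.ofReal (v x ^ ((N : ℝ) * p / ((N : ℝ) - p))) ≤
      (K * (∑' e : ZN N × ZN N, if adj e.1 e.2 then ENNReal.ofReal (|grad v e.1 e.2| ^ p) else 0)
        ^ (1 / p)) ^ ((N : ℝ) * p / ((N : ℝ) - p)) := by
  have hN' : (2 : ℝ) ≤ N := by exact_mod_cast hN
  have hNp : 0 < (N : ℝ) - p := by linarith
  have hN1 : 0 < (N : ℝ) - 1 := by linarith
  set s : ℝ := (N : ℝ) * p / ((N : ℝ) - p) with hs
  set g : ℝ := p * ((N : ℝ) - 1) / ((N : ℝ) - p) with hg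
  have hs0 : 0 < s := by positivity
  have hg1 : 1 < g := by
    rw [hg, lt_div_iff₀ hNp]; nlinarith
  have hgN : g * ((N : ℝ) / ((N : ℝ) - 1)) = s := by
    rw [hg, hs]; field_simp
  have hconj : (p / (p - 1)).HolderConjugate p :=
    (Real.HolderConjugate.conjExponent hp).symm
  have hgs : (g - 1) * (p / (p - 1)) = s := by
    have : p - 1 ≠ 0 := by linarith
    rw [hg, hs]; field_simp; ring
  refine ⟨N * (ENNReal.ofReal g * 2), by finiteness, fun v hv hfin => ?_⟩
  set X := ∑' x, ENNReal.ofReal (v x ^ s) with hX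
  set D := ∑' e : ZN N × ZN N, if adj e.1 e.2 then ENNReal.ofReal (|grad v e.1 e.2| ^ p) else 0
    with hD
  have hXtop : X ≠ ⊤ := by
    rw [hX, tsum_eq_sum (s := hfin.toFinset)]
    · exact ENNReal.sum_ne_top.2 fun _ _ => ENNReal.ofReal_ne_top
    · intro x hx
      have : v x = 0 := by simpa using hx
      simp [this, Real.zero_rpow hs0.ne']
  have hDi : ∀ i : Fin N, ∑' x, ENNReal.ofReal |v (x + Pi.single i 1) - v x| ^ p ≤ D := by
    intro i
    have hinj : Function.Injective (fun x : ZN N => (x, x + Pi.single i (1 : ℤ))) :=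
      fun x y h => (Prod.ext_iff.1 h).1
    refine le_trans (ENNReal.tsum_le_tsum fun x => ?_)
      (ENNReal.tsum_comp_le_tsum_of_injective hinj _)
    simp only [adj_add_single, if_true, grad]
    rw [ENNReal.ofReal_rpow_of_nonneg (abs_nonneg _) (by linarith)]
  have hpow : ∀ x, ENNReal.ofReal (v x ^ (g - 1)) ^ (p / (p - 1)) = ENNReal.ofReal (v x ^ s) := by
    intro x
    rw [ENNReal.ofReal_rpow_of_nonneg (Real.rpow_nonneg (hv x) _) hconj.nonneg,
      ← Real.rpow_mul (hv x), hgs]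
  set P := X ^ (1 / (p / (p - 1))) * D ^ (1 / p) with hP
  have hGi : ∀ i : Fin N, ∑' x, ENNReal.ofReal |v (x + Pi.single i 1) ^ g - v x ^ g| ≤
      ENNReal.ofReal g * 2 * P := by
    intro i
    have h1 : ∑' x, ENNReal.ofReal (v x ^ (g - 1)) * ENNReal.ofReal |v (x + Pi.single i 1) - v x|
        ≤ P := by
      refine (ENNReal.tsum_mul_le_Lp_mul_Lq hconj _ _).trans ?_
      simp only [hpow]
      exact mul_le_mul' le_rfl (ENNReal.rpow_le_rpow (hDi i) (by positivity))
    have h2 : ∑' x, ENNReal.ofReal (v (x + Pi.single i 1) ^ (g - 1)) *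
        ENNReal.ofReal |v (x + Pi.single i 1) - v x| ≤ P := by
      refine (ENNReal.tsum_mul_le_Lp_mul_Lq hconj _ _).trans ?_
      simp only [hpow]
      have hshift : ∑' x : ZN N, ENNReal.ofReal (v (x + Pi.single i 1) ^ s) = X :=
        (Equiv.addRight (Pi.single i (1 : ℤ) : ZN N)).tsum_eq
          (fun x => ENNReal.ofReal (v x ^ s))
      rw [hshift]
      exact mul_le_mul' le_rfl (ENNReal.rpow_le_rpow (hDi i) (by positivity))
    calc _ ≤ ∑' x, ENNReal.ofReal g * (ENNReal.ofReal (v (x + Pi.single i 1) ^ (g - 1)) *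
            ENNReal.ofReal |v (x + Pi.single i 1) - v x| +
            ENNReal.ofReal (v x ^ (g - 1)) * ENNReal.ofReal |v (x + Pi.single i 1) - v x|) := by
          refine ENNReal.tsum_le_tsum fun x => ?_
          have ha := Real.rpow_nonneg (hv x) (g - 1)
          have hb := Real.rpow_nonneg (hv (x + Pi.single i 1)) (g - 1)
          rw [← add_mul, ← ENNReal.ofReal_add hb ha, ← ENNReal.ofReal_mul (by positivity),
            ← ENNReal.ofReal_mul (by linarith)]
          exact ENNReal.ofReal_le_ofReal (abs_rpow_sub_rpow_le (hv _) (hv _) hg1)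
      _ ≤ ENNReal.ofReal g * (P + P) := by
          rw [ENNReal.tsum_mul_left, ENNReal.tsum_add]
          gcongr
      _ = _ := by rw [mul_assoc, two_mul]
  have hmain := tsum_rpow_le_tsum_grad hN (f := fun x => v x ^ g)
    (hfin.subset fun x hx => by
      contrapose! hx
      have : v x = 0 := by simpa using hx
      simp [this, Real.zero_rpow (by linarith : g ≠ 0)])
  have hl : ∀ x, ENNReal.ofReal |v x ^ g| ^ ((N : ℝ) / ((N : ℝ) - 1)) =
      ENNReal.ofReal (v x ^ s) := by
    intro x
    rw [abs_of_nonneg (Real.rpow_nonneg (hv x) _),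
      ENNReal.ofReal_rpow_of_nonneg (Real.rpow_nonneg (hv x) _) (by positivity),
      ← Real.rpow_mul (hv x), hgN]
  simp only [hl] at hmain
  have hmain2 : X ≤ (N * (ENNReal.ofReal g * 2) * P) ^ ((N : ℝ) / ((N : ℝ) - 1)) := by
    refine hmain.trans (ENNReal.rpow_le_rpow ?_ (by positivity))
    refine (Finset.sum_le_sum fun i _ => hGi i).trans_eq ?_
    simp [mul_assoc]
  rcases eq_or_ne X 0 with h0 | h0
  · simp [h0]
  set K : ℝ≥0∞ := N * (ENNReal.ofReal g * 2) with hK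
  have h3 : X ^ (((N : ℝ) - 1) / N) ≤ K * D ^ (1 / p) * X ^ ((p - 1) / p) := by
    have := ENNReal.rpow_le_rpow hmain2 (by positivity : 0 ≤ ((N : ℝ) - 1) / N)
    rw [← ENNReal.rpow_mul, show ((N : ℝ) / ((N : ℝ) - 1) * (((N : ℝ) - 1) / N)) = 1 by
      field_simp, ENNReal.rpow_one, hP, one_div_div] at this
    refine this.trans_eq ?_
    ring
  have h4 : X ^ (1 / s) ≤ K * D ^ (1 / p) := by
    have e : ((N : ℝ) - 1) / N = 1 / s + (p - 1) / p := by
      rw [hs]; field_simp; ring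
    rw [e, ENNReal.rpow_add _ _ h0 hXtop] at h3
    exact (ENNReal.mul_le_mul_iff_left (by simp [h0, hXtop])
      (ENNReal.rpow_ne_top_of_nonneg (div_nonneg (by linarith) (by linarith)) hXtop)).1 h3
  calc X = (X ^ (1 / s)) ^ s := by
        rw [← ENNReal.rpow_mul, one_div_mul_cancel hs0.ne', ENNReal.rpow_one]
    _ ≤ _ := ENNReal.rpow_le_rpow h4 hs0.le

lemma adj_comm {N : ℕ} {x y : ZN N} : adj x y ↔ adj y x := by
  unfold adj
  simp only [fun i => show (x i - y i).natAbs = (y i - x i).natAbs by omega]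

lemma finite_setOf_adj {N : ℕ} (x : ZN N) : {y | adj x y}.Finite := by
  refine (Set.finite_Icc (x - 1) (x + 1)).subset fun y hy => ?_
  have h : ∀ i, (x i - y i).natAbs ≤ 1 := fun i => by
    rw [← (show _ = 1 from hy)]
    exact Finset.single_le_sum (f := fun i => (x i - y i).natAbs) (fun _ _ => Nat.zero_le _)
      (Finset.mem_univ i)
  refine ⟨fun i => ?_, fun i => ?_⟩ <;> have := h i <;> simp <;> omega

/-- Every finite set of vertices has a finite closed neighbourhood. -/
lemma exists_finset_nbhd {N : ℕ} {F : Set (ZN N)} (hF : F.Finite) :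
    ∃ W : Finset (ZN N), F ⊆ W ∧ ∀ x ∈ F, ∀ y, adj x y → y ∈ W := by
  have h : (F ∪ ⋃ x ∈ F, {y | adj x y}).Finite :=
    hF.union (hF.biUnion fun x _ => finite_setOf_adj x)
  refine ⟨h.toFinset, fun x hx => ?_, fun x hx y hy => ?_⟩
  · simpa using Or.inl hx
  · simpa using Or.inr ⟨x, hx, hy⟩

lemma energy_le_of_grad_le {N : ℕ} {p q : ℝ} (hp : 0 < p) (hpq : p ≤ q) {a : ZN N → ℝ}
    (ha : ∀ x, 0 ≤ a x) {u v : ZN N → ℝ} {c : ℝ} (hc : 1 ≤ c)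
    (h : ∀ x y, |grad v x y| ≤ c * |grad u x y|) :
    energy p q a v ≤ ENNReal.ofReal (c ^ q) * energy p q a u := by
  have hq : 0 < q := hp.trans_le hpq
  have hc0 : 0 ≤ c := by linarith
  unfold energy eInt
  rw [← mul_div_assoc, ← ENNReal.tsum_mul_left]
  refine ENNReal.div_le_div_right (ENNReal.tsum_le_tsum fun e => ?_) _
  split_ifs
  · rw [← ENNReal.ofReal_mul (by positivity)]
    refine ENNReal.ofReal_le_ofReal ?_
    have h1 : |grad v e.1 e.2| ^ p ≤ c ^ q * |grad u e.1 e.2| ^ p := by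
      calc |grad v e.1 e.2| ^ p ≤ (c * |grad u e.1 e.2|) ^ p :=
            Real.rpow_le_rpow (abs_nonneg _) (h _ _) hp.le
        _ = c ^ p * |grad u e.1 e.2| ^ p := Real.mul_rpow hc0 (abs_nonneg _)
        _ ≤ _ := by gcongr
    have h2 : |grad v e.1 e.2| ^ q ≤ c ^ q * |grad u e.1 e.2| ^ q := by
      rw [← Real.mul_rpow hc0 (abs_nonneg _)]
      exact Real.rpow_le_rpow (abs_nonneg _) (h _ _) hq.le
    have := ha e.1
    calc 1 / p * |grad v e.1 e.2| ^ p + a e.1 / q * |grad v e.1 e.2| ^ q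
        ≤ 1 / p * (c ^ q * |grad u e.1 e.2| ^ p) + a e.1 / q * (c ^ q * |grad u e.1 e.2| ^ q) := by
          gcongr
      _ = _ := by ring
  · simp

lemma energy_ne_top_of_finite_support {N : ℕ} {p q : ℝ} (hp : p ≠ 0) (hq : q ≠ 0)
    {a u : ZN N → ℝ} (hu : (Function.support u).Finite) : energy p q a u ≠ ⊤ := by
  obtain ⟨W, hW, hW'⟩ := exists_finset_nbhd hu
  unfold energy eInt
  refine ENNReal.div_ne_top ?_ two_ne_zero
  rw [tsum_eq_sum (s := W ×ˢ W)]
  · refine ENNReal.sum_ne_top.2 fun e _ => ?_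
    split_ifs <;> simp
  · rintro ⟨x, y⟩ hxy
    split_ifs with hadj
    · have hx : u x = 0 := by
        by_contra hx
        exact hxy (Finset.mem_product.2 ⟨hW hx, hW' x hx y hadj⟩)
      have hy : u y = 0 := by
        by_contra hy
        exact hxy (Finset.mem_product.2 ⟨hW' y hy x (adj_comm.1 hadj), hW hy⟩)
      simp [grad, hx, hy, Real.zero_rpow hp, Real.zero_rpow hq]
    · rfl

lemma vsum_smul {N : ℕ} {r : ℝ} (v : ZN N → ℝ) {c : ℝ} (hc : 0 ≤ c) :
    vsum r (fun x => c * v x) = ENNReal.ofReal (c ^ r) * vsum r v := by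
  unfold vsum
  rw [← ENNReal.tsum_mul_left]
  refine tsum_congr fun x => ?_
  rw [← ENNReal.ofReal_mul (by positivity), abs_mul, abs_of_nonneg hc,
    Real.mul_rpow hc (abs_nonneg _)]

/-- The infimum defining `Slevel` may be taken over all functions on the sphere. -/
lemma Slevel_le_energy {N : ℕ} {p q r t : ℝ} (hp : 1 < p) (hpq : p < q) (hr : 0 < r) (ht : 0 < t)
    {a : ZN N → ℝ} (ha : ∀ x, 0 ≤ a x) {v : ZN N → ℝ}
    (hv : vsum r v = ENNReal.ofReal (r * t)) : Slevel p q a r t ≤ energy p q a v := by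
  rcases eq_or_ne (energy p q a v) ⊤ with hE | hE
  · rw [hE]; exact le_top
  have hrt : 0 < r * t := mul_pos hr ht
  have key : ∀ c : ℝ, 1 < c → Slevel p q a r t ≤ ENNReal.ofReal (c ^ q) * energy p q a v := by
    intro c hc
    have hc0 : 0 < c := by linarith
    have hcr : 1 < c ^ r := Real.one_lt_rpow hc hr
    obtain ⟨ε, hε, hεv⟩ : ∃ ε : ℝ, 0 < ε ∧
        ENNReal.ofReal (r * t / c ^ r) ≤ vsum r (fun x => max (|v x| - ε) 0) := by
      have hlt : ENNReal.ofReal (r * t / c ^ r) < ∑' x, ENNReal.ofReal (|v x| ^ r) := by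
        change _ < vsum r v
        rw [hv]
        exact (ENNReal.ofReal_lt_ofReal_iff hrt).2 (div_lt_self hrt hcr)
      rw [ENNReal.tsum_eq_iSup_sum, lt_iSup_iff] at hlt
      obtain ⟨F, hF⟩ := hlt
      have hcont : Tendsto (fun ε : ℝ => ∑ x ∈ F, ENNReal.ofReal (|max (|v x| - ε) 0| ^ r))
          (𝓝[>] 0) (𝓝 (∑ x ∈ F, ENNReal.ofReal (|v x| ^ r))) := by
        refine tendsto_finsetSum _ fun x _ => ENNReal.tendsto_ofReal ?_
        have : Continuous (fun ε : ℝ => |max (|v x| - ε) 0| ^ r) :=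
          Continuous.rpow_const (by fun_prop) fun _ => Or.inr hr.le
        have h2 := (this.tendsto 0).mono_left (nhdsWithin_le_nhds (s := Set.Ioi 0))
        simpa using h2
      obtain ⟨ε, h1, h2⟩ := ((hcont.eventually (lt_mem_nhds hF)).and self_mem_nhdsWithin).exists
      exact ⟨ε, h2, h1.le.trans (ENNReal.sum_le_tsum F)⟩
    set w : ZN N → ℝ := fun x => max (|v x| - ε) 0 with hw
    have hw0 : ∀ x, 0 ≤ w x := fun x => le_max_right _ _
    have hwv : vsum r w ≤ vsum r v := by
      refine ENNReal.tsum_le_tsum fun x => ENNReal.ofReal_le_ofReal ?_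
      refine Real.rpow_le_rpow (abs_nonneg _) ?_ hr.le
      rw [abs_of_nonneg (hw0 x)]
      exact max_le (by linarith) (abs_nonneg _)
    have hwfin : (Function.support w).Finite := by
      have hne : ∑' x, ENNReal.ofReal (|v x| ^ r) ≠ ⊤ := by
        change vsum r v ≠ ⊤
        rw [hv]; exact ENNReal.ofReal_ne_top
      refine (ENNReal.finite_const_le_of_tsum_ne_top hne
        (ε := ENNReal.ofReal (ε ^ r)) (by simpa using Real.rpow_pos_of_pos hε r)).subset ?_
      intro x hx
      have : ε < |v x| := by
        by_contra! h
        exact hx (max_eq_right (by linarith))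
      exact ENNReal.ofReal_le_ofReal (Real.rpow_le_rpow hε.le this.le hr.le)
    have hwtop : vsum r w ≠ ⊤ := ne_top_of_le_ne_top (by rw [hv]; exact ENNReal.ofReal_ne_top) hwv
    set V : ℝ := (vsum r w).toReal with hV
    have hVeq : vsum r w = ENNReal.ofReal V := (ENNReal.ofReal_toReal hwtop).symm
    have hVlow : r * t / c ^ r ≤ V := by
      rw [hVeq] at hεv
      exact (ENNReal.ofReal_le_ofReal_iff ENNReal.toReal_nonneg).1 hεv
    have hV0 : 0 < V := lt_of_lt_of_le (by positivity) hVlow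
    have hVup : V ≤ r * t := by
      rw [hVeq, hv] at hwv
      exact (ENNReal.ofReal_le_ofReal_iff hrt.le).1 hwv
    set k : ℝ := (r * t / V) ^ (1 / r) with hk
    have hk1 : 1 ≤ k := Real.one_le_rpow ((one_le_div hV0).2 hVup) (by positivity)
    have hkr : k ^ r = r * t / V := by
      rw [hk, ← Real.rpow_mul (by positivity), one_div_mul_cancel hr.ne', Real.rpow_one]
    have hkc : k ≤ c := by
      rw [← Real.rpow_le_rpow_iff (by linarith) hc0.le hr, hkr, div_le_iff₀ hV0]
      rwa [div_le_iff₀ (by positivity), mul_comm V] at hVlow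
    have hS : Slevel p q a r t ≤ energy p q a (fun x => k * w x) :=
      sInf_le ⟨fun x => k * w x, ?_, ?_, rfl⟩
    · refine hS.trans (energy_le_of_grad_le (by linarith) hpq.le ha hc.le fun x y => ?_)
      have h1 : |w y - w x| ≤ |v y - v x| :=
        (abs_max_sub_max_le_abs _ _ _).trans (by
          rw [sub_sub_sub_cancel_right]; exact abs_abs_sub_abs_le _ _)
      simp only [grad]
      rw [← mul_sub, abs_mul, abs_of_nonneg (by linarith : 0 ≤ k)]
      gcongr
    · exact hwfin.subset fun x hx => right_ne_zero_of_mul hx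
    · rw [vsum_smul _ (by linarith), hkr, hVeq, ← ENNReal.ofReal_mul (by positivity),
        div_mul_cancel₀ _ hV0.ne']
  have hlim : Tendsto (fun c : ℝ => ENNReal.ofReal (c ^ q) * energy p q a v) (𝓝[>] 1)
      (𝓝 (energy p q a v)) := by
    have h1 : Tendsto (fun c : ℝ => ENNReal.ofReal (c ^ q)) (𝓝[>] 1) (𝓝 1) := by
      have : Continuous (fun c : ℝ => c ^ q) :=
        continuous_id.rpow_const fun _ => Or.inr (by linarith)
      have h2 := (this.tendsto 1).mono_left (nhdsWithin_le_nhds (s := Set.Ioi 1))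
      simpa using ENNReal.tendsto_ofReal h2
    simpa using ENNReal.Tendsto.mul_const h1 (Or.inr hE)
  exact ge_of_tendsto hlim (by
    filter_upwards [self_mem_nhdsWithin] with c hc using key c hc)

lemma ENNReal.tsum_le_of_tendsto {α : Type*} {F : ℕ → α → ℝ≥0∞} {f : α → ℝ≥0∞}
    (hF : ∀ x, Tendsto (fun n => F n x) atTop (𝓝 (f x))) {B : ℕ → ℝ≥0∞} {b : ℝ≥0∞}
    (hFB : ∀ n, ∑' x, F n x ≤ B n) (hB : Tendsto B atTop (𝓝 b)) : ∑' x, f x ≤ b := by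
  rw [ENNReal.tsum_eq_iSup_sum]
  exact iSup_le fun s => le_of_tendsto_of_tendsto' (tendsto_finsetSum s fun x _ => hF x) hB
    fun n => (ENNReal.sum_le_tsum s).trans (hFB n)

lemma two_mul_energy {N : ℕ} (p q : ℝ) (a v : ZN N → ℝ) :
    ∑' e : ZN N × ZN N, (if adj e.1 e.2 then ENNReal.ofReal
      ((1 / p) * |grad v e.1 e.2| ^ p + (a e.1 / q) * |grad v e.1 e.2| ^ q) else 0) =
      2 * energy p q a v := by
  unfold energy eInt
  rw [ENNReal.mul_div_cancel two_ne_zero ENNReal.ofNat_ne_top]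

lemma tsum_grad_rpow_le_energy {N : ℕ} {p q : ℝ} (hp : 0 < p) (hq : 0 < q) {a : ZN N → ℝ}
    (ha : ∀ x, 0 ≤ a x) (v : ZN N → ℝ) :
    ∑' e : ZN N × ZN N, (if adj e.1 e.2 then ENNReal.ofReal (|grad v e.1 e.2| ^ p) else 0) ≤
      ENNReal.ofReal p * (2 * energy p q a v) := by
  rw [← two_mul_energy, ← ENNReal.tsum_mul_left]
  refine ENNReal.tsum_le_tsum fun e => ?_
  split_ifs
  · rw [← ENNReal.ofReal_mul hp.le]
    refine ENNReal.ofReal_le_ofReal ?_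
    have := ha e.1
    have h : 0 ≤ p * (a e.1 / q * |grad v e.1 e.2| ^ q) := by positivity
    rw [mul_add, ← mul_assoc, mul_one_div_cancel hp.ne', one_mul]
    linarith
  · simp

lemma mul_abs_grad_rpow_le_energy {N : ℕ} {p q : ℝ} (hp : 0 < p) (hq : 0 < q)
    {a v : ZN N → ℝ} {C : ℝ≥0∞} (hC : C ≠ ⊤) (hv : energy p q a v ≤ C)
    {x y : ZN N} (hxy : adj x y) : a x * |grad v x y| ^ q ≤ q * (2 * C.toReal) := by
  have h1 : ENNReal.ofReal ((1 / p) * |grad v x y| ^ p + (a x / q) * |grad v x y| ^ q) ≤ 2 * C := by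
    have := ENNReal.le_tsum (f := fun e : ZN N × ZN N => if adj e.1 e.2 then ENNReal.ofReal
      ((1 / p) * |grad v e.1 e.2| ^ p + (a e.1 / q) * |grad v e.1 e.2| ^ q) else 0) (x, y)
    rw [two_mul_energy] at this
    simp only [hxy, if_true] at this
    exact this.trans (by gcongr)
  rw [ENNReal.ofReal_le_iff_le_toReal (by finiteness)] at h1
  simp only [ENNReal.toReal_mul, ENNReal.toReal_ofNat] at h1
  have h2 : 0 ≤ 1 / p * |grad v x y| ^ p := by positivity
  have h3 : a x / q * |grad v x y| ^ q ≤ 2 * C.toReal := by linarith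
  calc a x * |grad v x y| ^ q = q * (a x / q * |grad v x y| ^ q) := by field_simp
    _ ≤ _ := by gcongr

/-- Nonnegative functions with bounded energy and bounded `ℓ^s` norm vanish uniformly at infinity,
because the weight `a` is coercive. -/
lemma exists_finset_forall_le {N : ℕ} (hN : 0 < N) {p q s : ℝ} (hp : 0 < p) (hq : 0 < q)
    (hs : 0 < s) {a : ZN N → ℝ} (hainf : Tendsto a cofinite atTop)
    {C M : ℝ≥0∞} (hC : C ≠ ⊤) (hM : M ≠ ⊤) {ε : ℝ} (hε : 0 < ε) :
    ∃ F : Finset (ZN N), ∀ v : ZN N → ℝ, (∀ x, 0 ≤ v x) → energy p q a v ≤ C →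
      ∑' x, ENNReal.ofReal (v x ^ s) ≤ M → ∀ x ∉ F, v x ≤ ε := by
  set i : Fin N := ⟨0, hN⟩
  set e : ZN N := Pi.single i 1 with he
  have hη : 0 < (ε / 2) ^ s := by positivity
  obtain ⟨k, hk⟩ := exists_nat_gt (M.toReal / (ε / 2) ^ s)
  have hk0 : 0 < (k : ℝ) := lt_of_le_of_lt (by positivity) hk
  rw [div_lt_iff₀ hη] at hk
  set δ : ℝ := ε / (2 * k) with hδ
  have hδ0 : 0 < δ := by positivity
  set A : ℝ := q * (2 * C.toReal) / δ ^ q + 1 with hA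
  have hA0 : 0 < A := by positivity
  have hbad : {x | a x < A}.Finite := by
    have := hainf.eventually (eventually_ge_atTop A)
    rw [eventually_cofinite] at this
    simpa using this
  have hinj : ∀ j : ℕ, Function.Injective (fun x : ZN N => x + j • e) :=
    fun j => add_left_injective _
  have hFfin : (⋃ j ∈ Finset.range k, (fun x : ZN N => x + j • e) ⁻¹' {x | a x < A}).Finite :=
    (Finset.finite_toSet _).biUnion fun j _ => hbad.preimage (hinj j).injOn
  refine ⟨hFfin.toFinset, fun v hv hvC hvM x hx => ?_⟩
  have hgood : ∀ j < k, A ≤ a (x + j • e) := by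
    intro j hj
    by_contra! h
    exact hx (by simpa using ⟨j, hj, h⟩)
  have hstep : ∀ j < k, |v (x + (j + 1) • e) - v (x + j • e)| ≤ δ := by
    intro j hj
    have hadj : adj (x + j • e) (x + (j + 1) • e) := by
      rw [add_smul, one_smul, ← add_assoc]
      exact adj_add_single _ _
    have h1 := mul_abs_grad_rpow_le_energy hp hq hC hvC hadj
    have h2 : A * |grad v (x + j • e) (x + (j + 1) • e)| ^ q ≤ q * (2 * C.toReal) :=
      le_trans (by gcongr; exact hgood j hj) h1
    have h3 : q * (2 * C.toReal) ≤ A * δ ^ q := by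
      rw [hA, add_mul, div_mul_cancel₀ _ (by positivity)]
      have : 0 ≤ 1 * δ ^ q := by positivity
      linarith
    exact (Real.rpow_le_rpow_iff (abs_nonneg _) hδ0.le hq).1
      (le_of_mul_le_mul_left (h2.trans h3) hA0)
  by_contra! hlt
  have hval : ∀ j ≤ k, ε - j * δ ≤ v (x + j • e) := by
    intro j
    induction j with
    | zero => intro _; simpa using hlt.le
    | succ j ih =>
      intro hj
      have h1 := ih (by omega)
      have h2 := (abs_le.1 (hstep j (by omega))).1
      push_cast
      linarith
  have hhalf : ∀ j < k, ε / 2 ≤ v (x + j • e) := by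
    intro j hj
    refine le_trans ?_ (hval j hj.le)
    have : (j : ℝ) * δ ≤ k * δ := by
      have : (j : ℝ) ≤ k := by exact_mod_cast hj.le
      gcongr
    have h2 : (k : ℝ) * δ = ε / 2 := by rw [hδ]; field_simp
    linarith
  have hinj2 : Function.Injective (fun j : ℕ => x + j • e) := by
    intro j j' h
    have := congrFun (add_left_cancel h) i
    simpa [he] using this
  have hsum : ENNReal.ofReal (k * (ε / 2) ^ s) ≤ M := by
    calc ENNReal.ofReal (k * (ε / 2) ^ s)
        = ∑ _j ∈ Finset.range k, ENNReal.ofReal ((ε / 2) ^ s) := by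
          rw [Finset.sum_const, Finset.card_range, nsmul_eq_mul, ENNReal.ofReal_mul hk0.le,
            ENNReal.ofReal_natCast]
      _ ≤ ∑ j ∈ Finset.range k, ENNReal.ofReal (v (x + j • e) ^ s) := by
          refine Finset.sum_le_sum fun j hj => ENNReal.ofReal_le_ofReal ?_
          exact Real.rpow_le_rpow (by positivity) (hhalf j (Finset.mem_range.1 hj)) hs.le
      _ ≤ ∑' j : ℕ, ENNReal.ofReal (v (x + j • e) ^ s) := ENNReal.sum_le_tsum _
      _ ≤ ∑' x, ENNReal.ofReal (v x ^ s) :=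
          ENNReal.tsum_comp_le_tsum_of_injective hinj2 (fun x => ENNReal.ofReal (v x ^ s))
      _ ≤ M := hvM
  rw [ENNReal.ofReal_le_iff_le_toReal hM] at hsum
  linarith

lemma Slevel_set_nonempty {N : ℕ} {p q r t : ℝ} (hr : 0 < r) (ht : 0 < t) (a : ZN N → ℝ) :
    { c : ℝ≥0∞ | ∃ u : ZN N → ℝ, (Function.support u).Finite ∧
      vsum r u = ENNReal.ofReal (r * t) ∧ energy p q a u = c }.Nonempty := by
  refine ⟨_, Pi.single 0 ((r * t) ^ (1 / r)), ?_, ?_, rfl⟩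
  · exact (Set.finite_singleton _).subset Pi.support_single_subset
  · unfold vsum
    rw [tsum_eq_single 0]
    · rw [Pi.single_eq_same, abs_of_nonneg (by positivity), ← Real.rpow_mul (by positivity),
        one_div_mul_cancel hr.ne', Real.rpow_one]
    · intro x hx
      simp [Real.zero_rpow hr.ne', hx]

/-- Existence of a nonnegative minimizer on the sphere. -/
lemma exists_nonneg_minimizer {N : ℕ} (hN : 2 ≤ N) {p q r t : ℝ} (hp : 1 < p)
    (hpN : p < (N : ℝ)) (hpq : p < q) {a : ZN N → ℝ} (ha : ∀ x, 0 ≤ a x)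
    (hainf : Tendsto a cofinite atTop) (hr : (N : ℝ) * p / ((N : ℝ) - p) < r) (ht : 0 < t) :
    ∃ u : ZN N → ℝ, (∀ x, 0 ≤ u x) ∧ vsum r u = ENNReal.ofReal (r * t) ∧
      energy p q a u = Slevel p q a r t ∧ Slevel p q a r t ≠ ⊤ := by
  have hNp : 0 < (N : ℝ) - p := by linarith
  have hp0 : 0 < p := by linarith
  have hq0 : 0 < q := by linarith
  have hN0 : 0 < N := by omega
  obtain ⟨K, hK, hsob⟩ := sobolev hN hp hpN
  set s : ℝ := (N : ℝ) * p / ((N : ℝ) - p) with hs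
  have hs0 : 0 < s := by
    have : (0 : ℝ) < N := by exact_mod_cast hN0
    positivity
  have hr0 : 0 < r := hs0.trans hr
  have hrt : 0 < r * t := mul_pos hr0 ht
  obtain ⟨c, hcanti, hclim, hcmem⟩ := exists_seq_tendsto_sInf
    (Slevel_set_nonempty (p := p) (q := q) hr0 ht a) (OrderBot.bddBelow _)
  change Tendsto c atTop (𝓝 (Slevel p q a r t)) at hclim
  choose w hwfin hwsum hwen using hcmem
  have hc0 : c 0 ≠ ⊤ := by
    rw [← hwen 0]
    exact energy_ne_top_of_finite_support hp0.ne' hq0.ne' (hwfin 0)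
  have hStop : Slevel p q a r t ≠ ⊤ :=
    ne_top_of_le_ne_top hc0 (hcanti.le_of_tendsto hclim 0)
  set v : ℕ → ZN N → ℝ := fun n x => |w n x| with hvdef
  have hv0 : ∀ n x, 0 ≤ v n x := fun n x => abs_nonneg _
  have hvfin : ∀ n, (Function.support (v n)).Finite := fun n =>
    (hwfin n).subset fun x hx => abs_ne_zero.1 hx
  have hvsum : ∀ n, vsum r (v n) = ENNReal.ofReal (r * t) := by
    intro n
    rw [← hwsum n]
    simp [vsum, hvdef]
  have hven : ∀ n, energy p q a (v n) ≤ c n := by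
    intro n
    have := energy_le_of_grad_le hp0 hpq.le ha (u := w n) (v := v n) le_rfl fun x y => by
      rw [one_mul]; exact abs_abs_sub_abs_le _ _
    simpa [hwen n] using this
  have hven0 : ∀ n, energy p q a (v n) ≤ c 0 := fun n => (hven n).trans (hcanti (Nat.zero_le n))
  set M : ℝ≥0∞ := (K * (ENNReal.ofReal p * (2 * c 0)) ^ (1 / p)) ^ s with hM
  have hMtop : M ≠ ⊤ := by
    refine ENNReal.rpow_ne_top_of_nonneg hs0.le (ENNReal.mul_ne_top hK ?_)
    exact ENNReal.rpow_ne_top_of_nonneg (by positivity) (by finiteness)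
  have hvM : ∀ n, ∑' x, ENNReal.ofReal (v n x ^ s) ≤ M := by
    intro n
    refine (hsob (v n) (hv0 n) (hvfin n)).trans (ENNReal.rpow_le_rpow ?_ hs0.le)
    refine mul_le_mul' le_rfl (ENNReal.rpow_le_rpow ?_ (by positivity))
    refine (tsum_grad_rpow_le_energy hp0 hq0 ha (v n)).trans ?_
    have := hven0 n
    gcongr
  have hvR : ∀ n x, v n x ≤ (r * t) ^ (1 / r) := by
    intro n x
    have h1 := (ENNReal.le_tsum x).trans_eq (hvsum n)
    rw [ENNReal.ofReal_le_ofReal_iff hrt.le, abs_of_nonneg (hv0 n x)] at h1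
    rw [one_div]
    exact (Real.le_rpow_inv_iff_of_pos (hv0 n x) hrt.le hr0).2 h1
  obtain ⟨u, hu, φ, hφ, hlim⟩ := (isCompact_univ_pi fun _ : ZN N =>
    (isCompact_Icc : IsCompact (Set.Icc (0 : ℝ) ((r * t) ^ (1 / r))))).tendsto_subseq
    (x := v) fun n x _ => ⟨hv0 n x, hvR n x⟩
  rw [tendsto_pi_nhds] at hlim
  have hu0 : ∀ x, 0 ≤ u x := fun x => (hu x trivial).1
  have hterm : ∀ x, Tendsto (fun n => ENNReal.ofReal (|v (φ n) x| ^ r)) atTop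
      (𝓝 (ENNReal.ofReal (|u x| ^ r))) := fun x =>
    ENNReal.tendsto_ofReal (((hlim x).abs).rpow_const (Or.inr hr0.le))
  have hup : vsum r u ≤ ENNReal.ofReal (r * t) :=
    ENNReal.tsum_le_of_tendsto hterm (B := fun _ => ENNReal.ofReal (r * t))
      (fun n => (hvsum (φ n)).le) tendsto_const_nhds
  have hlow : ∀ ε : ℝ, 0 < ε →
      ENNReal.ofReal (r * t) ≤ vsum r u + ENNReal.ofReal (ε ^ (r - s)) * M := by
    intro ε hε
    obtain ⟨F, hF⟩ := exists_finset_forall_le hN0 hp0 hq0 hs0 hainf hc0 hMtop hε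
    have h1 : ∀ n, ENNReal.ofReal (r * t) ≤ ∑ x ∈ F, ENNReal.ofReal (|v (φ n) x| ^ r) +
        ENNReal.ofReal (ε ^ (r - s)) * M := by
      intro n
      have hsplit : ∀ x, ENNReal.ofReal (|v (φ n) x| ^ r) ≤
          (if x ∈ F then ENNReal.ofReal (|v (φ n) x| ^ r) else 0) +
          ENNReal.ofReal (ε ^ (r - s)) * ENNReal.ofReal (v (φ n) x ^ s) := by
        intro x
        split_ifs with hx
        · exact le_self_add
        · rw [zero_add, ← ENNReal.ofReal_mul (by positivity), abs_of_nonneg (hv0 _ x)]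
          refine ENNReal.ofReal_le_ofReal ?_
          have hxε := hF (v (φ n)) (hv0 _) (hven0 _) (hvM _) x hx
          calc v (φ n) x ^ r = v (φ n) x ^ (r - s) * v (φ n) x ^ s := by
                rw [← Real.rpow_add_of_nonneg (hv0 _ x) (by linarith) hs0.le, sub_add_cancel]
            _ ≤ _ := mul_le_mul_of_nonneg_right
                (Real.rpow_le_rpow (hv0 _ x) hxε (by linarith)) (Real.rpow_nonneg (hv0 _ x) _)
      rw [← hvsum (φ n)]
      refine (ENNReal.tsum_le_tsum hsplit).trans ?_
      rw [ENNReal.tsum_add, ENNReal.tsum_mul_left]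
      refine add_le_add (le_of_eq ?_) (mul_le_mul' le_rfl (hvM _))
      rw [tsum_eq_sum (s := F) fun x hx => by simp [hx]]
      exact Finset.sum_congr rfl fun x hx => by simp [hx]
    have h2 := ge_of_tendsto' ((tendsto_finsetSum F fun x _ => hterm x).add_const
      (ENNReal.ofReal (ε ^ (r - s)) * M)) h1
    exact h2.trans (add_le_add (ENNReal.sum_le_tsum F) le_rfl)
  have hlow' : ENNReal.ofReal (r * t) ≤ vsum r u := by
    have h1 : Tendsto (fun ε : ℝ => ENNReal.ofReal (ε ^ (r - s))) (𝓝[>] 0) (𝓝 0) := by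
      have : Continuous (fun ε : ℝ => ε ^ (r - s)) :=
        continuous_id.rpow_const fun _ => Or.inr (by linarith)
      have h2 := (this.tendsto 0).mono_left (nhdsWithin_le_nhds (s := Set.Ioi 0))
      simpa [Real.zero_rpow (by linarith : r - s ≠ 0)] using ENNReal.tendsto_ofReal h2
    have h2 := (ENNReal.Tendsto.mul_const h1 (Or.inr hMtop)).const_add (vsum r u)
    rw [zero_mul, add_zero] at h2
    exact ge_of_tendsto h2 (by
      filter_upwards [self_mem_nhdsWithin] with ε hε using hlow ε hε)
  have hvs : vsum r u = ENNReal.ofReal (r * t) := le_antisymm hup hlow'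
  refine ⟨u, hu0, hvs, le_antisymm ?_ (Slevel_le_energy hp hpq hr0 ht ha hvs), hStop⟩
  have h2 : 2 * energy p q a u ≤ 2 * Slevel p q a r t := by
    rw [← two_mul_energy]
    refine ENNReal.tsum_le_of_tendsto
      (F := fun n (e : ZN N × ZN N) => if adj e.1 e.2 then ENNReal.ofReal
        ((1 / p) * |grad (v (φ n)) e.1 e.2| ^ p + (a e.1 / q) * |grad (v (φ n)) e.1 e.2| ^ q)
        else 0) (fun e => ?_) (B := fun n => 2 * c (φ n)) (fun n => ?_)
      (ENNReal.Tendsto.const_mul (hclim.comp hφ.tendsto_atTop) (Or.inr (by finiteness)))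
    · split_ifs
      · have hg : Tendsto (fun n => |grad (v (φ n)) e.1 e.2|) atTop (𝓝 |grad u e.1 e.2|) :=
          ((hlim e.2).sub (hlim e.1)).abs
        exact ENNReal.tendsto_ofReal (((hg.rpow_const (Or.inr hp0.le)).const_mul _).add
          ((hg.rpow_const (Or.inr hq0.le)).const_mul _))
      · exact tendsto_const_nhds
    · rw [two_mul_energy]
      have := hven (φ n)
      gcongr
  exact (ENNReal.mul_le_mul_iff_right two_ne_zero ENNReal.ofNat_ne_top).1 h2

lemma ENNReal.tsum_eq_sum_add_compl {α : Type*} (f : α → ℝ≥0∞) (s : Finset α) :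
    ∑' x, f x = ∑ x ∈ s, f x + ∑' x : ((s : Set α)ᶜ : Set α), f x := by
  rw [← Finset.tsum_subtype']
  exact (ENNReal.summable.tsum_add_tsum_compl ENNReal.summable).symm

/-- A minimizer of the energy also minimizes the finite part of the energy near the set where it is
perturbed. -/
lemma sum_le_sum_of_energy_le {N : ℕ} {p q : ℝ} (hp : 0 < p) (hq : 0 < q) {a : ZN N → ℝ}
    (ha : ∀ x, 0 ≤ a x) {u v : ZN N → ℝ} (hu : energy p q a u ≠ ⊤)
    (huv : energy p q a u ≤ energy p q a v) {Z : Set (ZN N)} {W : Finset (ZN N)} (hZW : Z ⊆ W)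
    (hZW' : ∀ x ∈ Z, ∀ y, adj x y → y ∈ W) (hZ : ∀ x ∉ Z, v x = u x) :
    ∑ x ∈ W, ∑ y ∈ W, (if adj x y then
        (1 / p) * |u y - u x| ^ p + (a x / q) * |u y - u x| ^ q else 0) ≤
      ∑ x ∈ W, ∑ y ∈ W, (if adj x y then
        (1 / p) * |v y - v x| ^ p + (a x / q) * |v y - v x| ^ q else 0) := by
  have hnn : ∀ (w : ZN N → ℝ) (x y : ZN N), 0 ≤ (if adj x y then
      (1 / p) * |w y - w x| ^ p + (a x / q) * |w y - w x| ^ q else 0) := by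
    intro w x y
    have := ha x
    split_ifs <;> positivity
  have hfin : ∀ w : ZN N → ℝ, ∑ e ∈ W ×ˢ W, (if adj e.1 e.2 then ENNReal.ofReal
      ((1 / p) * |grad w e.1 e.2| ^ p + (a e.1 / q) * |grad w e.1 e.2| ^ q) else 0) =
      ENNReal.ofReal (∑ x ∈ W, ∑ y ∈ W, (if adj x y then
        (1 / p) * |w y - w x| ^ p + (a x / q) * |w y - w x| ^ q else 0)) := by
    intro w
    rw [← Finset.sum_product', ENNReal.ofReal_sum_of_nonneg fun e _ => hnn w e.1 e.2]
    refine Finset.sum_congr rfl fun e _ => ?_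
    split_ifs <;> simp [grad]
  have h2 : 2 * energy p q a u ≤ 2 * energy p q a v := by gcongr
  have h2top : 2 * energy p q a u ≠ ⊤ := by finiteness
  rw [← two_mul_energy, ENNReal.tsum_eq_sum_add_compl _ (W ×ˢ W), hfin] at h2top
  rw [← two_mul_energy, ← two_mul_energy, ENNReal.tsum_eq_sum_add_compl _ (W ×ˢ W), hfin,
    ENNReal.tsum_eq_sum_add_compl _ (W ×ˢ W), hfin] at h2
  have hrest : ∀ e : (((W ×ˢ W : Finset (ZN N × ZN N)) : Set (ZN N × ZN N))ᶜ : Set (ZN N × ZN N)),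
      (if adj e.1.1 e.1.2 then ENNReal.ofReal
        ((1 / p) * |grad v e.1.1 e.1.2| ^ p + (a e.1.1 / q) * |grad v e.1.1 e.1.2| ^ q) else 0) =
      (if adj e.1.1 e.1.2 then ENNReal.ofReal
        ((1 / p) * |grad u e.1.1 e.1.2| ^ p + (a e.1.1 / q) * |grad u e.1.1 e.1.2| ^ q) else 0) := by
    rintro ⟨⟨x, y⟩, he⟩
    have he' : ¬ (x ∈ W ∧ y ∈ W) := by simpa using he
    by_cases hadj : adj x y
    · have hx : x ∉ Z := fun h => he' ⟨hZW h, hZW' x h y hadj⟩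
      have hy : y ∉ Z := fun h => he' ⟨hZW' y h x (adj_comm.1 hadj), hZW h⟩
      simp [grad, hZ x hx, hZ y hy]
    · simp [hadj]
  simp only [hrest] at h2
  have h3 := (ENNReal.add_le_add_iff_right (ENNReal.add_ne_top.1 h2top).2).1 h2
  exact (ENNReal.ofReal_le_ofReal_iff
    (Finset.sum_nonneg fun x _ => Finset.sum_nonneg fun y _ => hnn v x y)).1 h3

lemma Lop_eq_sum {N : ℕ} (p q : ℝ) (a u : ZN N → ℝ) {x : ZN N} {W : Finset (ZN N)}
    (hW : ∀ y, adj x y → y ∈ W) :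
    Lop p q a u x = -∑ y ∈ W, (if adj x y then |u y - u x| ^ (p - 2) * (u y - u x) +
      ((a x + a y) / 2) * (|u y - u x| ^ (q - 2) * (u y - u x)) else 0) := by
  have h : ∀ y ∉ W, ¬ adj x y := fun y hy hadj => hy (hW y hadj)
  unfold Lop
  rw [tsum_eq_sum (s := W) fun y hy => if_neg (h y hy),
    tsum_eq_sum (s := W) fun y hy => if_neg (h y hy), ← neg_add', ← Finset.sum_add_distrib]
  congr 1
  refine Finset.sum_congr rfl fun y _ => ?_
  split_ifs <;> simp

/-- The first variation of the local energy in a direction `d` supported in `Z`. -/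
lemma sum_variation_eq {N : ℕ} (p q : ℝ) (a u d : ZN N → ℝ) {Z W : Finset (ZN N)} (hZW : Z ⊆ W)
    (hZW' : ∀ x ∈ Z, ∀ y, adj x y → y ∈ W) (hd : ∀ x ∉ Z, d x = 0) :
    ∑ x ∈ W, ∑ y ∈ W, (if adj x y then (|u y - u x| ^ (p - 2) * (u y - u x) +
      a x * (|u y - u x| ^ (q - 2) * (u y - u x))) * (d y - d x) else 0) =
      2 * ∑ x ∈ Z, d x * Lop p q a u x := by
  set ψ : ZN N → ZN N → ℝ := fun x y => |u y - u x| ^ (p - 2) * (u y - u x) +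
      a x * (|u y - u x| ^ (q - 2) * (u y - u x)) with hψ
  have h1 : ∑ x ∈ W, ∑ y ∈ W, (if adj x y then ψ x y * (d y - d x) else 0) =
      ∑ x ∈ W, ∑ y ∈ W, (if adj x y then ψ x y * d y else 0) -
      ∑ x ∈ W, ∑ y ∈ W, (if adj x y then ψ x y * d x else 0) := by
    simp_rw [← Finset.sum_sub_distrib]
    refine Finset.sum_congr rfl fun x _ => Finset.sum_congr rfl fun y _ => ?_
    split_ifs <;> ring
  rw [h1, Finset.sum_comm, ← Finset.sum_sub_distrib, Finset.mul_sum]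
  refine (Finset.sum_subset hZW fun x _ hx => ?_).symm.trans (Finset.sum_congr rfl fun x hx => ?_)
  · simp [hd x hx]
  · rw [Lop_eq_sum p q a u (hZW' x hx), ← Finset.sum_sub_distrib, ← Finset.sum_neg_distrib,
      Finset.mul_sum, Finset.mul_sum]
    refine Finset.sum_congr rfl fun y _ => ?_
    by_cases h : adj x y
    · have h' := adj_comm.1 h
      simp only [h, h', if_true, hψ, abs_sub_comm (u x) (u y)]
      ring
    · have h' : ¬ adj y x := fun h' => h (adj_comm.1 h')
      simp [h', h]

/-- The Euler-Lagrange equation with eliminated multiplier. -/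
lemma Lop_mul_rpow_eq {N : ℕ} {p q r t : ℝ} (hp : 1 < p) (hpq : p < q) (hr : 1 < r) (ht : 0 < t)
    {a : ZN N → ℝ} (ha : ∀ x, 0 ≤ a x) {u : ZN N → ℝ} (hu0 : ∀ x, 0 ≤ u x)
    (hur : vsum r u = ENNReal.ofReal (r * t)) (huE : energy p q a u = Slevel p q a r t)
    (hS : Slevel p q a r t ≠ ⊤) {x₀ x₁ : ZN N} (hne : x₀ ≠ x₁) (hx₁ : 0 < u x₁) :
    Lop p q a u x₀ * u x₁ ^ (r - 1) = Lop p q a u x₁ * u x₀ ^ (r - 1) := by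
  have hp0 : 0 < p := by linarith
  have hq1 : 1 < q := by linarith
  have hq0 : 0 < q := by linarith
  have hr0 : 0 < r := by linarith
  set B : ℝ → ℝ := fun s => u x₁ ^ r + u x₀ ^ r - |u x₀ + s| ^ r with hB
  set w : ℝ → ℝ := fun s => B s ^ (1 / r) with hw
  have hB0 : B 0 = u x₁ ^ r := by simp [hB, abs_of_nonneg (hu0 x₀)]
  have hB0pos : 0 < B 0 := by rw [hB0]; positivity
  have hw0 : w 0 = u x₁ := by
    rw [hw]; simp only [hB0]
    rw [← Real.rpow_mul hx₁.le, mul_one_div_cancel hr0.ne', Real.rpow_one]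
  have hBd : HasDerivAt B (-(r * u x₀ ^ (r - 1))) 0 := by
    have h1 : HasDerivAt (fun s : ℝ => u x₀ + s) 1 0 := (hasDerivAt_id (0 : ℝ)).const_add _
    have h2 := (hasDerivAt_abs_rpow (u x₀ + 0) hr).comp (0 : ℝ) h1
    have h3 := h2.const_sub (u x₁ ^ r + u x₀ ^ r)
    refine h3.congr_deriv ?_
    rw [add_zero, abs_of_nonneg (hu0 x₀), mul_one, mul_assoc]
    rcases (hu0 x₀).eq_or_lt with h | h
    · rw [← h, Real.zero_rpow (by linarith : r - 1 ≠ 0), mul_zero]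
    · rw [← Real.rpow_add_one h.ne']; ring_nf
  set w' : ℝ := -(r * u x₀ ^ (r - 1)) * (1 / r) * B 0 ^ (1 / r - 1) with hw'
  have hwd : HasDerivAt w w' 0 := hBd.rpow_const (Or.inl hB0pos.ne')
  have hw_deriv : w' * u x₁ ^ (r - 1) = -u x₀ ^ (r - 1) := by
    have : (u x₁ ^ r) ^ (1 / r - 1) * u x₁ ^ (r - 1) = 1 := by
      rw [← Real.rpow_mul hx₁.le, ← Real.rpow_add hx₁,
        show r * (1 / r - 1) + (r - 1) = 0 by field_simp; ring, Real.rpow_zero]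
    rw [hw', hB0, mul_assoc, this]
    field_simp
  set v : ℝ → ZN N → ℝ := fun s x => if x = x₀ then u x₀ + s else if x = x₁ then w s else u x
    with hv
  set d : ZN N → ℝ := fun x => if x = x₀ then 1 else if x = x₁ then w' else 0 with hd
  have hv0 : v 0 = u := by
    ext x
    simp only [hv, hw0, add_zero]
    split_ifs with h h'
    · rw [h]
    · rw [h']
    · rfl
  have hvd : ∀ x, HasDerivAt (fun s => v s x) (d x) 0 := by
    intro x
    simp only [hv, hd]
    split_ifs
    · exact (hasDerivAt_id (0 : ℝ)).const_add _
    · exact hwd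
    · exact hasDerivAt_const _ _
  set Z : Finset (ZN N) := {x₀, x₁} with hZ
  have hvZ : ∀ s, ∀ x ∉ Z, v s x = u x := by
    intro s x hx
    simp only [hZ, Finset.mem_insert, Finset.mem_singleton, not_or] at hx
    simp [hv, hx.1, hx.2]
  have hdZ : ∀ x ∉ Z, d x = 0 := by
    intro x hx
    simp only [hZ, Finset.mem_insert, Finset.mem_singleton, not_or] at hx
    simp [hd, hx.1, hx.2]
  have hvs : ∀ s, 0 < B s → vsum r (v s) = ENNReal.ofReal (r * t) := by
    intro s hs
    rw [← hur]
    unfold vsum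
    rw [ENNReal.tsum_eq_sum_add_compl _ Z, ENNReal.tsum_eq_sum_add_compl _ Z]
    congr 1
    · rw [hZ, Finset.sum_pair hne, Finset.sum_pair hne, ← ENNReal.ofReal_add (by positivity)
        (by positivity), ← ENNReal.ofReal_add (by positivity) (by positivity)]
      congr 1
      have h1 : |w s| ^ r = B s := by
        rw [abs_of_nonneg (Real.rpow_nonneg hs.le _), ← Real.rpow_mul hs.le,
          one_div_mul_cancel hr0.ne', Real.rpow_one]
      simp only [hv, if_true, hne.symm, if_false, h1, hB, abs_of_nonneg (hu0 _)]
      ring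
    · exact tsum_congr fun x => by rw [hvZ s x fun hx => x.2 (Finset.mem_coe.2 hx)]
  obtain ⟨W, hZW, hZW'⟩ := exists_finset_nbhd (Finset.finite_toSet Z)
  set J : ℝ → ℝ := fun s => ∑ x ∈ W, ∑ y ∈ W, (if adj x y then
        (1 / p) * |v s y - v s x| ^ p + (a x / q) * |v s y - v s x| ^ q else 0) with hJ
  have hmin : IsLocalMin J 0 := by
    have : ∀ᶠ s in 𝓝 (0 : ℝ), 0 < B s := hBd.continuousAt.eventually (lt_mem_nhds hB0pos)
    filter_upwards [this] with s hs
    simp only [hJ, hv0]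
    exact sum_le_sum_of_energy_le hp0 hq0 ha (huE ▸ hS)
      (huE ▸ Slevel_le_energy hp hpq hr0 ht ha (hvs s hs)) hZW hZW' (hvZ s)
  have hJd : HasDerivAt J (∑ x ∈ W, ∑ y ∈ W, (if adj x y then
      (|u y - u x| ^ (p - 2) * (u y - u x) +
      a x * (|u y - u x| ^ (q - 2) * (u y - u x))) * (d y - d x) else 0)) 0 := by
    refine HasDerivAt.fun_sum fun x _ => HasDerivAt.fun_sum fun y _ => ?_
    split_ifs
    · have hsub : HasDerivAt (fun s => v s y - v s x) (d y - d x) 0 := (hvd y).sub (hvd x)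
      have h1 := (hasDerivAt_abs_rpow (v 0 y - v 0 x) hp).comp (0 : ℝ) hsub
      have h2 := (hasDerivAt_abs_rpow (v 0 y - v 0 x) hq1).comp (0 : ℝ) hsub
      rw [hv0] at h1 h2
      refine ((h1.const_mul (1 / p)).add (h2.const_mul (a x / q))).congr_deriv ?_
      field_simp
    · exact hasDerivAt_const _ _
  have hzero := hmin.hasDerivAt_eq_zero hJd
  rw [sum_variation_eq p q a u d (by exact_mod_cast hZW) (by exact_mod_cast hZW') hdZ, hZ,
    Finset.sum_pair hne] at hzero
  simp only [hd, if_true, hne.symm, if_false, one_mul] at hzero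
  have h0 : Lop p q a u x₀ = -(w' * Lop p q a u x₁) := by linarith
  rw [h0]
  linear_combination -(Lop p q a u x₁) * hw_deriv

/-- A property of lattice points that is stable under passing to neighbours holds everywhere as soon
as it holds somewhere. -/
lemma forall_of_adj {N : ℕ} {P : ZN N → Prop} (h : ∀ x y, adj x y → P x → P y) {x₀ : ZN N}
    (h₀ : P x₀) (x : ZN N) : P x := by
  let H : AddSubgroup (ZN N) :=
    { carrier := {z | ∀ x, P x ↔ P (x + z)}
      zero_mem' := fun x => by rw [add_zero]
      add_mem' := fun {b c} hb hc x => by rw [← add_assoc, ← hc, ← hb]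
      neg_mem' := fun {b} hb x => by rw [hb (x + -b), neg_add_cancel_right] }
  have hmem : ∀ z : ZN N, z ∈ H := by
    intro z
    have hz : z = ∑ i, z i • (Pi.single i 1 : ZN N) := by
      simpa [← Pi.single_smul] using (Finset.univ_sum_single z).symm
    rw [hz]
    refine sum_mem fun i _ => zsmul_mem ?_ _
    exact fun x => ⟨h _ _ (adj_add_single x i), h _ _ (adj_comm.1 (adj_add_single x i))⟩
  have := (hmem (x - x₀) x₀).1 h₀
  simpa using this

lemma gradModular_le_energy {N : ℕ} {p q : ℝ} (hp : 0 < p) (hpq : p ≤ q)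
    (a u : ZN N → ℝ) :
    gradModular p q a u ≤ ENNReal.ofReal q * energy p q a u := by
  have hq : 0 < q := hp.trans_le hpq
  unfold gradModular energy eInt
  rw [← mul_div_assoc, ← ENNReal.tsum_mul_left]
  refine ENNReal.div_le_div_right (ENNReal.tsum_le_tsum fun e => ?_) _
  split_ifs
  · rw [← ENNReal.ofReal_mul hq.le]
    refine ENNReal.ofReal_le_ofReal ?_
    have h1 : 1 * |grad u e.1 e.2| ^ p ≤ q / p * |grad u e.1 e.2| ^ p := by
      gcongr
      rwa [one_le_div hp]
    have h2 : q * (1 / p * |grad u e.1 e.2| ^ p + a e.1 / q * |grad u e.1 e.2| ^ q) =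
        q / p * |grad u e.1 e.2| ^ p + a e.1 * |grad u e.1 e.2| ^ q := by
      field_simp
    rw [h2]
    linarith
  · simp

/-- A nonnegative nonzero function with finite `vsum` has a maximum point with a neighbour at which
the function is strictly smaller. -/
lemma exists_max_strict {N : ℕ} (hN : 0 < N) {r : ℝ} (hr : 0 < r) {u : ZN N → ℝ}
    (hu0 : ∀ x, 0 ≤ u x) (hne : vsum r u ≠ 0) (htop : vsum r u ≠ ⊤) :
    ∃ x, 0 < u x ∧ (∀ y, u y ≤ u x) ∧ ∃ y, adj x y ∧ u y < u x := by
  have hlevel : ∀ ε : ℝ, 0 < ε → {x | ε ≤ u x}.Finite := by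
    intro ε hε
    refine (ENNReal.finite_const_le_of_tsum_ne_top htop
        (ε := ENNReal.ofReal (ε ^ r)) (by simpa using Real.rpow_pos_of_pos hε r)).subset ?_
    intro x hx
    have hx' : ε ≤ |u x| := le_trans hx (le_abs_self _)
    exact ENNReal.ofReal_le_ofReal (Real.rpow_le_rpow hε.le hx' hr.le)
  obtain ⟨x₀, hx₀⟩ : ∃ x, 0 < u x := by
    by_contra! h
    refine hne (ENNReal.tsum_eq_zero.2 fun x => ?_)
    simp [le_antisymm (h x) (hu0 x), Real.zero_rpow hr.ne']
  obtain ⟨x₁, hx₁, hmax⟩ := (hlevel _ hx₀).exists_maximalFor u _ ⟨x₀, le_refl (u x₀)⟩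
  have hx₁pos : 0 < u x₁ := hx₀.trans_le hx₁
  have hmax' : ∀ y, u y ≤ u x₁ := by
    intro y
    by_contra! h
    exact absurd (hmax (hx₁.trans h.le) h.le) (not_le.2 h)
  set i : Fin N := ⟨0, hN⟩
  obtain ⟨x₂, hx₂, hmax₂⟩ := (hlevel _ hx₁pos).exists_maximalFor (fun x => x i) _
    ⟨x₁, le_refl (u x₁)⟩
  refine ⟨x₂, hx₁pos.trans_le hx₂, fun y => (hmax' y).trans hx₂, _, adj_add_single x₂ i, ?_⟩
  refine lt_of_lt_of_le ?_ hx₂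
  by_contra! h
  have := hmax₂ h (by simp)
  simp at this

lemma Lop_pos_of_max {N : ℕ} (p q : ℝ) {a : ZN N → ℝ} (ha : ∀ x, 0 ≤ a x) {u : ZN N → ℝ}
    {x y : ZN N} (hmax : ∀ z, u z ≤ u x) (hxy : adj x y) (hy : u y < u x) :
    0 < Lop p q a u x := by
  obtain ⟨W, -, hW⟩ := exists_finset_nbhd (Set.finite_singleton x)
  rw [Lop_eq_sum p q a u (hW x rfl), ← Finset.sum_neg_distrib]
  have hterm : ∀ z, 0 ≤ |u z - u x| ^ (p - 2) * (u x - u z) ∧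
      0 ≤ ((a x + a z) / 2) * (|u z - u x| ^ (q - 2) * (u x - u z)) := by
    intro z
    have h1 := sub_nonneg.2 (hmax z)
    have h2 := ha x
    have h3 := ha z
    constructor <;> positivity
  refine Finset.sum_pos' (fun z _ => ?_) ⟨y, hW x rfl y hxy, ?_⟩
  · have := hterm z
    split_ifs
    · linarith [this.1, this.2]
    · simp
  · have h1 := (hterm y).2
    have h2 : 0 < |u y - u x| ^ (p - 2) * (u x - u y) :=
      mul_pos (Real.rpow_pos_of_pos (abs_pos.2 (by linarith)) _) (by linarith)
    rw [if_pos hxy]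
    linarith

lemma Lop_neg_of_min {N : ℕ} (p q : ℝ) {a : ZN N → ℝ} (ha : ∀ x, 0 ≤ a x) {u : ZN N → ℝ}
    {x y : ZN N} (hmin : ∀ z, u x ≤ u z) (hxy : adj x y) (hy : u x < u y) :
    Lop p q a u x < 0 := by
  have h := Lop_pos_of_max p q ha (u := fun z => -u z) (x := x) (y := y)
    (fun z => neg_le_neg (hmin z)) hxy (neg_lt_neg hy)
  obtain ⟨W, -, hW⟩ := exists_finset_nbhd (Set.finite_singleton x)
  rw [Lop_eq_sum p q a _ (hW x rfl), ← Finset.sum_neg_distrib] at h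
  rw [Lop_eq_sum p q a u (hW x rfl), neg_lt_zero]
  refine h.trans_eq (Finset.sum_congr rfl fun z _ => ?_)
  split_ifs
  · rw [show -u z - -u x = -(u z - u x) by ring, abs_neg]
    ring
  · simp

/-- existence of a positive solution to the constrained minimization problem
(and the associated eigenvalue problem) when `a(x) → +∞` as `|x| → ∞`. -/
theorem statement1 {N : ℕ} (hN : 2 ≤ N) (p q : ℝ) (hp : 1 < p) (hpN : p < (N : ℝ))
    (hpq : p < q) (a : ZN N → ℝ) (ha : ∀ x, 0 ≤ a x)
    (hainf : Tendsto a cofinite atTop)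
    (pstar : ℝ) (hpstar : pstar = (N : ℝ) * p / ((N : ℝ) - p))
    (r : ℝ) (hr : pstar < r) :
    ∀ t : ℝ, 0 < t → ∃ (u : ZN N → ℝ) (lam : ℝ), 0 < lam ∧ (∀ x, 0 < u x) ∧
      vsum r u = ENNReal.ofReal (r * t) ∧ gradModular p q a u < ⊤ ∧
      energy p q a u = Slevel p q a r t ∧
      ∀ x₀ : ZN N, Lop p q a u x₀ = lam * (u x₀) ^ (r - 1) := by
  intro t ht
  have hp0 : 0 < p := by linarith
  have hN0 : 0 < N := by omega
  have hNp : 0 < (N : ℝ) - p := by linarith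
  have hr1 : 1 < r := by
    refine lt_trans ?_ hr
    rw [hpstar, lt_div_iff₀ hNp]
    nlinarith
  have hr0 : 0 < r := by linarith
  have hrt : 0 < r * t := mul_pos hr0 ht
  obtain ⟨u, hu0, hur, huE, hS⟩ :=
    exists_nonneg_minimizer hN hp hpN hpq ha hainf (hpstar ▸ hr) ht
  obtain ⟨x₁, hx₁, hmax, y, hxy, hy⟩ := exists_max_strict hN0 hr0 hu0
    (by rw [hur]; simpa using hrt) (by rw [hur]; exact ENNReal.ofReal_ne_top)
  have hL := Lop_pos_of_max p q ha hmax hxy hy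
  have hpow : 0 < u x₁ ^ (r - 1) := Real.rpow_pos_of_pos hx₁ _
  have hEL : ∀ x₀, Lop p q a u x₀ = Lop p q a u x₁ / u x₁ ^ (r - 1) * u x₀ ^ (r - 1) := by
    intro x₀
    rcases eq_or_ne x₀ x₁ with rfl | hne
    · rw [div_mul_cancel₀ _ hpow.ne']
    · rw [div_mul_eq_mul_div, eq_div_iff hpow.ne']
      exact Lop_mul_rpow_eq hp hpq hr1 ht ha hu0 hur huE hS hne hx₁
  refine ⟨u, Lop p q a u x₁ / u x₁ ^ (r - 1), div_pos hL hpow, fun x => ?_, hur, ?_, huE, hEL⟩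
  · refine (hu0 x).lt_of_ne fun hx => hx₁.ne ?_
    refine forall_of_adj (P := fun x => 0 = u x) (fun x y hxy hx => ?_) hx x₁
    by_contra hy
    have h1 := Lop_neg_of_min p q ha (fun z => hx ▸ hu0 z) hxy
      (hx ▸ lt_of_le_of_ne (hu0 y) hy)
    rw [hEL x, ← hx, Real.zero_rpow (by linarith), mul_zero] at h1
    exact lt_irrefl _ h1
  · refine (gradModular_le_energy hp0 hpq.le a u).trans_lt ?_
    rw [huE]
    exact ENNReal.mul_lt_top ENNReal.ofReal_lt_top hS.lt_top
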